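/- arXiv:2603.05761 — 5 statements merged into one kernel-verified Lean document; each statement's English description precedes it below -/
import Mathlib

section
/- Let D be a positive natural number, let μ be a nonzero finite measure on ℝ^D with compact support, and let σ > 0. Let φ_σ(z) = (2πσ²)^{-D/2} exp(−‖z‖²/(2σ²)) be the density of the isotropic Gaussian N(0, σ² I_D). Define p_σ(x) = ∫ φ_σ(x − y) dμ(y) and the posterior mean m(x) = (∫ y · φ_σ(x − y) dμ(y)) / p_σ(x). Then p_σ is everywhere positive and differentiable, and for every x ∈ ℝ^D, ∇ log p_σ(x) = (m(x) − x)/σ². -/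
open MeasureTheory Real

/-- Tweedie's formula for the Gaussian noising model `X = Y + σZ` with `Y ~ μ`
a nonzero finite compactly supported measure and `Z ~ N(0, I_D)`: the marginal
`p_σ` is positive and differentiable and `∇ log p_σ(x) = (m(x) − x)/σ²`, where
`m(x)` is the posterior mean. -/
theorem tweedie_formula
    (D : ℕ) (hD : 0 < D)
    (μ : Measure (EuclideanSpace ℝ (Fin D))) [IsFiniteMeasure μ] (hμ : μ ≠ 0)
    (hμc : ∃ K : Set (EuclideanSpace ℝ (Fin D)), IsCompact K ∧ μ Kᶜ = 0)
    (σ : ℝ) (hσ : 0 < σ)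
    (φ : EuclideanSpace ℝ (Fin D) → ℝ)
    (hφ : ∀ z, φ z = (2 * π * σ ^ 2) ^ (-(D : ℝ) / 2) * Real.exp (-‖z‖ ^ 2 / (2 * σ ^ 2)))
    (pσ : EuclideanSpace ℝ (Fin D) → ℝ)
    (hpσ : ∀ x, pσ x = ∫ y, φ (x - y) ∂μ)
    (m : EuclideanSpace ℝ (Fin D) → EuclideanSpace ℝ (Fin D))
    (hm : ∀ x, m x = (pσ x)⁻¹ • ∫ y, φ (x - y) • y ∂μ) :
    (∀ x, 0 < pσ x) ∧ Differentiable ℝ pσ ∧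
      ∀ x, gradient (fun y => Real.log (pσ y)) x = (σ ^ 2)⁻¹ • (m x - x) := by
  set c : ℝ := (2 * π * σ ^ 2) ^ (-(D : ℝ) / 2) with hc
  have hc0 : 0 < c := by positivity
  have hφpos : ∀ z, 0 < φ z := fun z => by rw [hφ]; positivity
  have hφle : ∀ z, φ z ≤ c := fun z => by
    rw [hφ]
    have : Real.exp (-‖z‖ ^ 2 / (2 * σ ^ 2)) ≤ 1 := by
      rw [Real.exp_le_one_iff]
      apply div_nonpos_of_nonpos_of_nonneg
      · simp
      · positivity
    nlinarith
  have hφeq : φ = fun z => c * Real.exp (-‖z‖ ^ 2 / (2 * σ ^ 2)) := funext hφ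
  have hφcont : Continuous φ := by
    rw [hφeq]; fun_prop
  have hint : ∀ x, Integrable (fun y => φ (x - y)) μ := fun x => by
    refine Integrable.of_bound (C := c) (by fun_prop) (Filter.Eventually.of_forall fun y => ?_)
    rw [Real.norm_of_nonneg (hφpos _).le]
    exact hφle _
  obtain ⟨K, hK, hK0⟩ := hμc
  obtain ⟨R, hR⟩ := hK.isBounded.exists_norm_le
  have hae : ∀ᵐ y ∂μ, ‖y‖ ≤ R := by
    have : ∀ᵐ y ∂μ, y ∈ K := hK0
    filter_upwards [this] with y hy using hR y hy
  have hinty : ∀ x, Integrable (fun y => φ (x - y) • y) μ := fun x => by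
    refine Integrable.of_bound (C := c * R) (by fun_prop) ?_
    filter_upwards [hae] with y hy
    rw [norm_smul, Real.norm_of_nonneg (hφpos _).le]
    exact mul_le_mul (hφle _) hy (norm_nonneg _) hc0.le
  have hpos : ∀ x, 0 < pσ x := fun x => by
    rw [hpσ, integral_pos_iff_support_of_nonneg (fun y => (hφpos _).le) (hint x)]
    have : Function.support (fun y => φ (x - y)) = Set.univ := by
      ext y; simp [(hφpos (x - y)).ne']
    rw [this]
    exact Measure.measure_univ_pos.2 hμ
  have hdφ : ∀ z, HasFDerivAt φ (innerSL ℝ ((-(φ z * (σ ^ 2)⁻¹)) • z)) z := fun z => by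
    have h1 := (((hasStrictFDerivAt_norm_sq z).hasFDerivAt.neg.mul_const
      ((2 * σ ^ 2)⁻¹)).exp).const_mul c
    have h2 : φ = fun z => c * Real.exp ((-‖z‖ ^ 2) * (2 * σ ^ 2)⁻¹) := by
      rw [hφeq]; simp only [div_eq_mul_inv]
    rw [h2]
    refine h1.congr_fderiv ?_
    ext v
    simp
    field_simp
  have hd : ∀ x, HasFDerivAt pσ (innerSL ℝ ((pσ x * (σ ^ 2)⁻¹) • (m x - x))) x := fun x => by
    have hG : Integrable (fun y => (-(φ (x - y) * (σ ^ 2)⁻¹)) • (x - y)) μ := by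
      have h := (((hinty x).sub ((hint x).smul_const x)).smul ((σ ^ 2)⁻¹))
      refine h.congr (Filter.Eventually.of_forall fun y => ?_)
      simp only [Pi.smul_apply, Pi.sub_apply]
      module
    have key := hasFDerivAt_integral_of_dominated_of_fderiv_le (𝕜 := ℝ) (μ := μ) (x₀ := x)
      (s := Metric.ball x 1)
      (F := fun x y => φ (x - y))
      (F' := fun x y => innerSL ℝ ((-(φ (x - y) * (σ ^ 2)⁻¹)) • (x - y)))
      (bound := fun _ => (c * (σ ^ 2)⁻¹) * (‖x‖ + 1 + R))
      (Metric.ball_mem_nhds x one_pos)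
      (Filter.Eventually.of_forall fun x => (hint x).aestronglyMeasurable)
      (hint x)
      ((innerSL ℝ).continuous.comp_aestronglyMeasurable hG.aestronglyMeasurable)
      (by
        filter_upwards [hae] with y hy z hz
        rw [innerSL_apply_norm, norm_smul, norm_neg,
          Real.norm_of_nonneg (mul_nonneg (hφpos _).le (by positivity))]
        have h1 : ‖z‖ ≤ ‖x‖ + 1 := by
          have : ‖z - x‖ < 1 := by simpa [dist_eq_norm] using hz
          have := norm_le_norm_add_norm_sub' z x
          linarith
        have h2 := norm_sub_le z y
        refine mul_le_mul (mul_le_mul_of_nonneg_right (hφle _) (by positivity)) (by linarith)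
          (norm_nonneg _) (by positivity))
      (integrable_const _)
      (Filter.Eventually.of_forall fun y z _ => by
        exact (hasFDerivAt_comp_sub y).2 (hdφ (z - y)))
    have hp : pσ = fun x => ∫ y, φ (x - y) ∂μ := funext hpσ
    have hI : (∫ y, innerSL ℝ ((-(φ (x - y) * (σ ^ 2)⁻¹)) • (x - y)) ∂μ)
        = innerSL ℝ ((pσ x * (σ ^ 2)⁻¹) • (m x - x)) := by
      have h0 : (∫ y, innerSL ℝ ((-(φ (x - y) * (σ ^ 2)⁻¹)) • (x - y)) ∂μ)
        = innerSL ℝ (∫ y, (-(φ (x - y) * (σ ^ 2)⁻¹)) • (x - y) ∂μ) :=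
        (innerSL ℝ).integral_comp_comm hG
      rw [h0]
      congr 1
      have h1 : (fun y => (-(φ (x - y) * (σ ^ 2)⁻¹)) • (x - y))
          = fun y => (σ ^ 2)⁻¹ • (φ (x - y) • y - φ (x - y) • x) := by
        funext y; module
      rw [h1, integral_smul, integral_sub (hinty x) ((hint x).smul_const x),
        integral_smul_const, ← hpσ, hm, mul_comm, mul_smul, smul_sub (pσ x),
        smul_inv_smul₀ (hpos x).ne']
    rw [← hI, hp]
    exact key
  refine ⟨hpos, fun x => (hd x).differentiableAt, fun x => ?_⟩
  apply HasGradientAt.gradient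
  rw [hasGradientAt_iff_hasFDerivAt]
  refine ((hd x).log (hpos x).ne').congr_fderiv ?_
  have := (hpos x).ne'
  ext v
  simp
  field_simp
end

section
/- Let D be a positive natural number, let μ be a nonzero finite measure on ℝ^D with compact support, and let t ∈ (0,1). Let φ_t(z) = (2πt²)^{-D/2} exp(−‖z‖²/(2t²)) be the density of N(0, t² I_D). Define the Rectified-Flow marginal p_t(x) = ∫ φ_t(x − (1−t)y) dμ(y) and the posterior mean x̂₀(x) = (∫ y · φ_t(x − (1−t)y) dμ(y)) / p_t(x). Then p_t is everywhere positive and differentiable, and for every x ∈ ℝ^D, ∇ log p_t(x) = ((1−t)·x̂₀(x) − x)/t². -/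
open MeasureTheory Real

/-- Tweedie-type formula for the Rectified-Flow marginal
`p_t(x) = ∫ φ_t(x − (1−t)y) dμ(y)` with data law `μ` (a nonzero finite compactly
supported measure): `p_t` is positive and differentiable and
`∇ log p_t(x) = ((1−t)·xhat₀(x) − x)/t²`, where `xhat₀` is the posterior mean. -/
theorem rf_tweedie_formula
    (D : ℕ) (hD : 0 < D)
    (μ : Measure (EuclideanSpace ℝ (Fin D))) [IsFiniteMeasure μ] (hμ : μ ≠ 0)
    (hμc : ∃ K : Set (EuclideanSpace ℝ (Fin D)), IsCompact K ∧ μ Kᶜ = 0)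
    (t : ℝ) (ht : t ∈ Set.Ioo (0 : ℝ) 1)
    (φ : EuclideanSpace ℝ (Fin D) → ℝ)
    (hφ : ∀ z, φ z = (2 * π * t ^ 2) ^ (-(D : ℝ) / 2) * Real.exp (-‖z‖ ^ 2 / (2 * t ^ 2)))
    (pt : EuclideanSpace ℝ (Fin D) → ℝ)
    (hpt : ∀ x, pt x = ∫ y, φ (x - (1 - t) • y) ∂μ)
    (xhat₀ : EuclideanSpace ℝ (Fin D) → EuclideanSpace ℝ (Fin D))
    (hxhat₀ : ∀ x, xhat₀ x = (pt x)⁻¹ • ∫ y, φ (x - (1 - t) • y) • y ∂μ) :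
    (∀ x, 0 < pt x) ∧ Differentiable ℝ pt ∧
      ∀ x, gradient (fun y => Real.log (pt y)) x
          = (t ^ 2)⁻¹ • ((1 - t) • xhat₀ x - x) := by
  obtain ⟨K, hK, hK0⟩ := hμc
  have ht0 : 0 < t := ht.1
  have hrest : μ.restrict K = μ := Measure.restrict_eq_self_of_ae_mem (by
    rw [ae_iff]; exact hK0)
  have haeK : ∀ᵐ y ∂μ, y ∈ K := by rw [ae_iff]; exact hK0
  have hint : ∀ {F : Type} [NormedAddCommGroup F]
      (f : EuclideanSpace ℝ (Fin D) → F), Continuous f → Integrable f μ := by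
    intro F _ f hf
    have := hf.continuousOn.integrableOn_compact (μ := μ) hK
    rwa [IntegrableOn, hrest] at this
  have hφe : φ = fun z => (2 * π * t ^ 2) ^ (-(D : ℝ) / 2) * Real.exp (-‖z‖ ^ 2 / (2 * t ^ 2)) :=
    funext hφ
  have hφc : Continuous φ := by rw [hφe]; fun_prop
  have hφpos : ∀ z, 0 < φ z := by intro z; rw [hφ]; positivity
  have hφd : ∀ z, HasFDerivAt φ (φ z • innerSL ℝ (-(t ^ 2)⁻¹ • z)) z := by
    intro z
    have h1 := (((hasStrictFDerivAt_norm_sq z).hasFDerivAt.const_mul (-(2 * t ^ 2)⁻¹)).exp).const_mul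
      ((2 * π * t ^ 2) ^ (-(D : ℝ) / 2))
    have e : φ = fun z => (2 * π * t ^ 2) ^ (-(D : ℝ) / 2) *
        Real.exp (-(2 * t ^ 2)⁻¹ * ‖z‖ ^ 2) := by
      rw [hφe]; funext z; congr 2; field_simp
    have e2 := congrFun e z
    rw [e2, e]
    refine h1.congr_fderiv ?_
    ext w
    simp [inner_smul_left]
    field_simp
  have hpos : ∀ x, 0 < pt x := by
    intro x
    rw [hpt]
    have hi : Integrable (fun y => φ (x - (1 - t) • y)) μ := hint _ (by fun_prop)
    rw [integral_pos_iff_support_of_nonneg (fun y => (hφpos _).le) hi]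
    have : Function.support (fun y => φ (x - (1 - t) • y)) = Set.univ := by
      ext y; simp [(hφpos _).ne']
    rw [this]
    exact Measure.measure_univ_pos.2 hμ
  let F' : EuclideanSpace ℝ (Fin D) → EuclideanSpace ℝ (Fin D) →
      (EuclideanSpace ℝ (Fin D) →L[ℝ] ℝ) := fun x y =>
    φ (x - (1 - t) • y) • innerSL ℝ (-(t ^ 2)⁻¹ • (x - (1 - t) • y))
  have hF'c : Continuous (fun p : EuclideanSpace ℝ (Fin D) × EuclideanSpace ℝ (Fin D) =>
      F' p.1 p.2) := by
    have h2 : Continuous (fun p : EuclideanSpace ℝ (Fin D) × EuclideanSpace ℝ (Fin D) =>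
      -(t ^ 2)⁻¹ • (p.1 - (1 - t) • p.2)) := by fun_prop
    exact (hφc.comp (by fun_prop)).smul ((innerSL ℝ).continuous.comp h2)
  have hder : ∀ x, HasFDerivAt pt (∫ y, F' x y ∂μ) x := by
    intro x
    obtain ⟨C, hC⟩ := ((isCompact_closedBall x 1).prod hK).exists_bound_of_continuousOn
      hF'c.continuousOn
    have e : pt = fun x => ∫ y, φ (x - (1 - t) • y) ∂μ := funext hpt
    rw [e]
    refine hasFDerivAt_integral_of_dominated_of_fderiv_le (bound := fun _ => C)
      (Metric.closedBall_mem_nhds x one_pos) ?_ ?_ ?_ ?_ (integrable_const C) ?_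
    · exact Filter.Eventually.of_forall fun x' => (hint _ (by fun_prop)).aestronglyMeasurable
    · exact hint _ (by fun_prop)
    · exact (hint _ (hF'c.comp (by fun_prop : Continuous fun y => (x, y)))).aestronglyMeasurable
    · filter_upwards [haeK] with y hy x' hx'
      exact hC (x', y) ⟨hx', hy⟩
    · refine Filter.Eventually.of_forall fun y x' _ => ?_
      exact ((hφd (x' - (1 - t) • y)).comp x' ((hasFDerivAt_id x').sub_const ((1 - t) • y))).congr_fderiv (ContinuousLinearMap.comp_id _)
  refine ⟨hpos, fun x => (hder x).differentiableAt, fun x => ?_⟩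
  apply HasGradientAt.gradient
  rw [hasGradientAt_iff_hasFDerivAt]
  refine ((hder x).log (hpos x).ne').congr_fderiv ?_
  have hi1 : Integrable (fun y => φ (x - (1 - t) • y)) μ := hint _ (by fun_prop)
  have hi2 : Integrable (fun y => φ (x - (1 - t) • y) • y) μ := hint _ (by fun_prop)
  have hi3 : Integrable (fun y => F' x y) μ :=
    hint _ (hF'c.comp (by fun_prop : Continuous fun y => (x, y)))
  have hG : ∫ y, φ (x - (1 - t) • y) • (-(t ^ 2)⁻¹ • (x - (1 - t) • y)) ∂μ
      = pt x • (t ^ 2)⁻¹ • ((1 - t) • xhat₀ x - x) := by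
    have : ∀ y, φ (x - (1 - t) • y) • (-(t ^ 2)⁻¹ • (x - (1 - t) • y))
      = (t ^ 2)⁻¹ • ((1 - t) • (φ (x - (1 - t) • y) • y) - φ (x - (1 - t) • y) • x) := by
      intro y; module
    simp_rw [this]
    rw [integral_smul, integral_sub (hint _ (by fun_prop)) (hi1.smul_const x), integral_smul,
      integral_smul_const, ← hpt, smul_comm (pt x), smul_sub (pt x), smul_comm (pt x) (1 - t),
      hxhat₀, smul_inv_smul₀ (hpos x).ne']
  ext w
  have hi4 : Integrable (fun y => φ (x - (1 - t) • y) • (-(t ^ 2)⁻¹ • (x - (1 - t) • y))) μ :=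
    hint _ (by fun_prop)
  have h5 : (∫ y, F' x y ∂μ) w = inner ℝ w (pt x • (t ^ 2)⁻¹ • ((1 - t) • xhat₀ x - x)) := by
    rw [ContinuousLinearMap.integral_apply hi3, ← hG, ← integral_inner hi4]
    refine integral_congr_ae (Filter.Eventually.of_forall fun y => ?_)
    simp only [F', ContinuousLinearMap.smul_apply, innerSL_apply_apply, inner_smul_right, smul_eq_mul]
    rw [real_inner_comm, inner_smul_right]
  rw [ContinuousLinearMap.smul_apply, h5, InnerProductSpace.toDual_apply_apply, inner_smul_right,
    smul_eq_mul, inv_mul_cancel_left₀ (hpos x).ne', real_inner_comm]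
end

section
/- Let D be a positive natural number, let μ be a nonzero finite measure on ℝ^D with compact support, and let t ∈ (0,1). With φ_t, p_t and x̂₀ as follows: φ_t(z) = (2πt²)^{-D/2} exp(−‖z‖²/(2t²)), p_t(x) = ∫ φ_t(x − (1−t)y) dμ(y), x̂₀(x) = (∫ y · φ_t(x − (1−t)y) dμ(y)) / p_t(x), for every x ∈ ℝ^D the drift function (x − x̂₀(x))/t satisfies the identity (x − x̂₀(x))/t = −x/(1−t) − (t/(1−t)) · ∇ log p_t(x). -/
open MeasureTheory Real

theorem rf_aux_integrable {E F : Type*} [NormedAddCommGroup E] [MeasurableSpace E] [BorelSpace E]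
    [SecondCountableTopology E] [NormedAddCommGroup F]
    (μ : Measure E) [IsFiniteMeasure μ] (K : Set E) (hK : IsCompact K) (hK0 : μ Kᶜ = 0)
    (f : E → F) (hf : Continuous f) : Integrable f μ := by
  obtain ⟨C, hC⟩ := hK.exists_bound_of_continuousOn hf.continuousOn
  refine Integrable.of_bound hf.aestronglyMeasurable C ?_
  have : ∀ᵐ y ∂μ, y ∈ K := hK0
  filter_upwards [this] with y hy using hC y hy

/-- Rectified-Flow velocity–score relation: with `p_t` the RF marginal and
`xhat₀` the posterior mean, the drift `(x − xhat₀(x))/t` satisfies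
`(x − xhat₀(x))/t = −x/(1−t) − (t/(1−t)) ∇ log p_t(x)`. -/
theorem rf_velocity_score_relation
    (D : ℕ) (hD : 0 < D)
    (μ : Measure (EuclideanSpace ℝ (Fin D))) [IsFiniteMeasure μ] (hμ : μ ≠ 0)
    (hμc : ∃ K : Set (EuclideanSpace ℝ (Fin D)), IsCompact K ∧ μ Kᶜ = 0)
    (t : ℝ) (ht : t ∈ Set.Ioo (0 : ℝ) 1)
    (φ : EuclideanSpace ℝ (Fin D) → ℝ)
    (hφ : ∀ z, φ z = (2 * π * t ^ 2) ^ (-(D : ℝ) / 2) * Real.exp (-‖z‖ ^ 2 / (2 * t ^ 2)))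
    (pt : EuclideanSpace ℝ (Fin D) → ℝ)
    (hpt : ∀ x, pt x = ∫ y, φ (x - (1 - t) • y) ∂μ)
    (xhat₀ : EuclideanSpace ℝ (Fin D) → EuclideanSpace ℝ (Fin D))
    (hxhat₀ : ∀ x, xhat₀ x = (pt x)⁻¹ • ∫ y, φ (x - (1 - t) • y) • y ∂μ) :
    ∀ x, t⁻¹ • (x - xhat₀ x)
        = -((1 - t)⁻¹ • x)
          - (t / (1 - t)) • gradient (fun y => Real.log (pt y)) x := by
  obtain ⟨K, hK, hK0⟩ := hμc
  obtain ⟨ht0, ht1⟩ := ht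
  have hKae : ∀ᵐ y ∂μ, y ∈ K := hK0
  set c : ℝ := (2 * π * t ^ 2) ^ (-(D : ℝ) / 2) with hc
  have hcpos : 0 < c := by positivity
  have hφpos : ∀ z, 0 < φ z := fun z => by rw [hφ]; positivity
  have hφc : Continuous φ := by
    have : φ = fun z => c * Real.exp (-‖z‖ ^ 2 / (2 * t ^ 2)) := funext hφ
    rw [this]; fun_prop
  intro x
  let G : EuclideanSpace ℝ (Fin D) → EuclideanSpace ℝ (Fin D) → EuclideanSpace ℝ (Fin D) :=
    fun x y => φ (x - (1 - t) • y) • ((-(t ^ 2)⁻¹) • (x - (1 - t) • y))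
  have hGc : Continuous (fun p : EuclideanSpace ℝ (Fin D) × EuclideanSpace ℝ (Fin D) =>
      G p.1 p.2) := by
    simp only [G]; fun_prop
  have hGx : Continuous (G x) := by simp only [G]; fun_prop
  have hφd : ∀ z, HasFDerivAt φ (innerSL ℝ (φ z • ((-(t ^ 2)⁻¹) • z))) z := by
    intro z
    have h1 : HasFDerivAt (fun z : EuclideanSpace ℝ (Fin D) => ‖z‖ ^ 2)
        (2 • (innerSL ℝ z)) z := (hasStrictFDerivAt_norm_sq z).hasFDerivAt
    have h2 := ((h1.const_mul (-(2 * t ^ 2)⁻¹)).exp).const_mul c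
    have he : φ = fun z => c * Real.exp (-(2 * t ^ 2)⁻¹ * ‖z‖ ^ 2) := by
      funext z; rw [hφ]; congr 2; field_simp
    rw [he]
    refine h2.congr_fderiv (ContinuousLinearMap.ext fun v => ?_)
    simp only [map_smul, ContinuousLinearMap.smul_apply, innerSL_apply_apply, smul_eq_mul,
      nsmul_eq_mul, Nat.cast_ofNat]
    field_simp
  have hpos : 0 < pt x := by
    rw [hpt, integral_pos_iff_support_of_nonneg (fun y => (hφpos _).le)
      (rf_aux_integrable μ K hK hK0 _ (by fun_prop))]
    have : (Function.support fun y => φ (x - (1 - t) • y)) = Set.univ :=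
      Set.eq_univ_of_forall fun y => (hφpos _).ne'
    rw [this]
    exact Measure.measure_univ_pos.2 hμ
  have hGint : Integrable (G x) μ := rf_aux_integrable μ K hK hK0 _ hGx
  have hd : HasFDerivAt pt (innerSL ℝ (∫ y, G x y ∂μ)) x := by
    have hpe : pt = fun x => ∫ y, φ (x - (1 - t) • y) ∂μ := funext hpt
    obtain ⟨C, hC⟩ := ((isCompact_closedBall x 1).prod hK).exists_bound_of_continuousOn
      hGc.continuousOn
    rw [hpe, ← (innerSL ℝ (E := EuclideanSpace ℝ (Fin D))).integral_comp_comm hGint]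
    refine hasFDerivAt_integral_of_dominated_of_fderiv_le
      (F' := fun x y => innerSL ℝ (G x y)) (bound := fun _ => C)
      (Metric.closedBall_mem_nhds x one_pos) ?_ ?_ ?_ ?_ ?_ ?_
    · exact Filter.Eventually.of_forall fun x' =>
        Continuous.aestronglyMeasurable (by fun_prop)
    · exact rf_aux_integrable μ K hK hK0 _ (by fun_prop)
    · exact ((innerSL ℝ).continuous.comp hGx).aestronglyMeasurable
    · filter_upwards [hKae] with y hy x' hx'
      rw [innerSL_apply_norm]
      exact hC (x', y) ⟨hx', hy⟩
    · exact integrable_const C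
    · refine Filter.Eventually.of_forall fun y x' _ => ?_
      have := (hφd (x' - (1 - t) • y)).comp x' ((hasFDerivAt_id x').sub_const ((1 - t) • y))
      exact this
  have hg : gradient (fun y => Real.log (pt y)) x = (pt x)⁻¹ • ∫ y, G x y ∂μ := by
    apply HasGradientAt.gradient
    rw [hasGradientAt_iff_hasFDerivAt]
    refine (hd.log hpos.ne').congr_fderiv (ContinuousLinearMap.ext fun v => ?_)
    rw [InnerProductSpace.toDual_apply_apply, inner_smul_left]
    simp
  have hI1 : Integrable (fun y => φ (x - (1 - t) • y)) μ :=
    rf_aux_integrable μ K hK hK0 _ (by fun_prop)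
  have hI2 : Integrable (fun y => φ (x - (1 - t) • y) • y) μ :=
    rf_aux_integrable μ K hK hK0 _ (by fun_prop)
  have hI3 : Integrable (fun y => (1 - t) • φ (x - (1 - t) • y) • y) μ := hI2.smul (1 - t)
  have hGe : ∫ y, G x y ∂μ = (-(t ^ 2)⁻¹) • (pt x • x
      - (1 - t) • ∫ y, φ (x - (1 - t) • y) • y ∂μ) := by
    rw [hpt, ← integral_smul_const, ← integral_smul, ← integral_sub (hI1.smul_const x) hI3,
      ← integral_smul]
    congr 1
    funext y
    simp only [G]
    module
  rw [hg, hGe, hxhat₀]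
  have h1t : 1 - t ≠ 0 := by linarith
  have hp := hpos.ne'
  have ht' := ht0.ne'
  generalize (∫ y, φ (x - (1 - t) • y) • y ∂μ) = w
  match_scalars
  · field_simp
    ring
  · field_simp
end

section
/- Let D be a positive natural number, let μ be a nonzero finite measure on ℝ^D with compact support, let L : ℝ^D → ℝ be a bounded measurable function with L ≥ 0 and ∫ L dμ > 0, and let t ∈ (0,1). With φ_t(z) = (2πt²)^{-D/2} exp(−‖z‖²/(2t²)), define p_t(x) = ∫ φ_t(x − (1−t)x₀) dμ(x₀), q_t(x) = (∫ L(x₀) φ_t(x − (1−t)x₀) dμ(x₀)) / (∫ L dμ), and g(x) = (∫ L(x₀) φ_t(x − (1−t)x₀) dμ(x₀)) / p_t(x). Then at every x ∈ ℝ^D with q_t(x) > 0, the functions log q_t, log p_t and log g are differentiable and ∇ log q_t(x) = ∇ log p_t(x) + ∇ log g(x). -/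
open MeasureTheory Real

lemma aux_diff {E : Type*} [NormedAddCommGroup E] [InnerProductSpace ℝ E] [FiniteDimensional ℝ E]
    [MeasurableSpace E] [BorelSpace E] (μ : Measure E) [IsFiniteMeasure μ]
    (W : E → ℝ) (hW : Measurable W) (C : ℝ) (hWC : ∀ x, |W x| ≤ C)
    (φ : E → ℝ) (hφ : ContDiff ℝ 1 φ) (M : ℝ) (h1 : ∀ z, |φ z| ≤ M)
    (h2 : ∀ z, ‖fderiv ℝ φ z‖ ≤ M) (a : ℝ) (x : E) :
    DifferentiableAt ℝ (fun y => ∫ x₀, W x₀ * φ (y - a • x₀) ∂μ) x := by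
  have hc : Continuous φ := hφ.continuous
  have hc' : Continuous (fderiv ℝ φ) := hφ.continuous_fderiv (by norm_num)
  have hC : 0 ≤ C := (abs_nonneg _).trans (hWC 0)
  have hm : ∀ y, AEStronglyMeasurable (fun x₀ => W x₀ * φ (y - a • x₀)) μ := fun y =>
    hW.aestronglyMeasurable.mul (Continuous.aestronglyMeasurable (by fun_prop))
  have := hasFDerivAt_integral_of_dominated_of_fderiv_le (𝕜 := ℝ) (μ := μ)
    (F := fun y x₀ => W x₀ * φ (y - a • x₀))
    (F' := fun y x₀ => W x₀ • fderiv ℝ φ (y - a • x₀)) (x₀ := x) (s := Set.univ)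
    (bound := fun _ => C * M) Filter.univ_mem (Filter.Eventually.of_forall hm)
    ?_ ?_ ?_ (integrable_const _) ?_
  · exact this.differentiableAt
  · refine Integrable.of_bound (hm x) (C * M) (Filter.Eventually.of_forall fun x₀ => ?_)
    rw [norm_mul]
    exact mul_le_mul (hWC _) (h1 _) (norm_nonneg _) hC
  · exact hW.aestronglyMeasurable.smul (Continuous.aestronglyMeasurable (by fun_prop))
  · refine Filter.Eventually.of_forall fun x₀ y _ => ?_
    rw [norm_smul]
    exact mul_le_mul (hWC _) (h2 _) (norm_nonneg _) hC
  · refine Filter.Eventually.of_forall fun x₀ y _ => ?_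
    have hd : HasFDerivAt φ (fderiv ℝ φ (y - a • x₀)) (y - a • x₀) :=
      ((hφ.differentiable (by norm_num)) _).hasFDerivAt
    have := (hd.comp y ((hasFDerivAt_id y).sub_const (a • x₀))).const_mul (W x₀)
    simpa using this

lemma aux_bound {E : Type*} [NormedAddCommGroup E] [InnerProductSpace ℝ E]
    (c t : ℝ) (hc : 0 ≤ c) (ht : 0 < t) (z : E) :
    ‖fderiv ℝ (fun z : E => c * Real.exp (-‖z‖ ^ 2 / (2 * t ^ 2))) z‖ ≤ c / t := by
  have h0 : HasFDerivAt (fun z : E => ‖z‖ ^ 2) (2 • (innerSL ℝ z)) z :=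
    (hasStrictFDerivAt_norm_sq z).hasFDerivAt
  have h := ((h0.neg.mul_const ((2 * t ^ 2)⁻¹)).exp).const_mul c
  simp only [← div_eq_mul_inv] at h
  have h' : fderiv ℝ (fun z : E => c * Real.exp (-‖z‖ ^ 2 / (2 * t ^ 2))) z = _ := h.fderiv
  rw [h']
  have e : ‖(2 : ℕ) • innerSL ℝ z‖ = 2 * ‖z‖ := by
    rw [← Nat.cast_smul_eq_nsmul ℝ, norm_smul, innerSL_apply_norm]; simp
  simp only [norm_smul, norm_neg, e, Pi.neg_apply]
  rw [Real.norm_of_nonneg hc, Real.norm_of_nonneg (Real.exp_pos _).le,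
    Real.norm_of_nonneg (by positivity), neg_div, Real.exp_neg]
  have hv := Real.add_one_le_exp (‖z‖ ^ 2 / (2 * t ^ 2))
  have hz : ‖z‖ / t ≤ Real.exp (‖z‖ ^ 2 / (2 * t ^ 2)) := by
    refine le_trans ?_ hv
    have : ‖z‖ ^ 2 / (2 * t ^ 2) = (‖z‖ / t) ^ 2 / 2 := by field_simp
    rw [this]
    nlinarith [sq_nonneg (‖z‖ / t - 1)]
  have hp := Real.exp_pos (‖z‖ ^ 2 / (2 * t ^ 2))
  generalize Real.exp (‖z‖ ^ 2 / (2 * t ^ 2)) = X at *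
  calc c * (X⁻¹ * ((2 * t ^ 2)⁻¹ * (2 * ‖z‖))) = c / t * ((‖z‖ / t) / X) := by field_simp
    _ ≤ c / t * 1 := by
      gcongr
      exact (div_le_one hp).2 hz
    _ = c / t := mul_one _

/-- Score of the conditional (posterior) Rectified-Flow path: with prior `μ`,
likelihood `L`, RF kernel `φ_t`, unconditional marginal `p_t`, conditional
marginal `q_t`, and conditional likelihood `g(x) = E[L(X₀) | X_t = x]`, at every
point where `q_t > 0` the log-densities are differentiable and
`∇ log q_t = ∇ log p_t + ∇ log g`. -/
theorem conditional_score_decomposition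
    (D : ℕ) (hD : 0 < D)
    (μ : Measure (EuclideanSpace ℝ (Fin D))) [IsFiniteMeasure μ] (hμ : μ ≠ 0)
    (hμc : ∃ K : Set (EuclideanSpace ℝ (Fin D)), IsCompact K ∧ μ Kᶜ = 0)
    (L : EuclideanSpace ℝ (Fin D) → ℝ) (hLmeas : Measurable L)
    (hL0 : ∀ x₀, 0 ≤ L x₀) (hLbdd : ∃ Cb : ℝ, ∀ x₀, L x₀ ≤ Cb)
    (hLint : 0 < ∫ x₀, L x₀ ∂μ)
    (t : ℝ) (ht : t ∈ Set.Ioo (0 : ℝ) 1)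
    (φ : EuclideanSpace ℝ (Fin D) → ℝ)
    (hφ : ∀ z, φ z = (2 * π * t ^ 2) ^ (-(D : ℝ) / 2) * Real.exp (-‖z‖ ^ 2 / (2 * t ^ 2)))
    (pt : EuclideanSpace ℝ (Fin D) → ℝ)
    (hpt : ∀ x, pt x = ∫ x₀, φ (x - (1 - t) • x₀) ∂μ)
    (qt : EuclideanSpace ℝ (Fin D) → ℝ)
    (hqt : ∀ x, qt x = (∫ x₀, L x₀ * φ (x - (1 - t) • x₀) ∂μ) / ∫ x₀, L x₀ ∂μ)
    (g : EuclideanSpace ℝ (Fin D) → ℝ)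
    (hg : ∀ x, g x = (∫ x₀, L x₀ * φ (x - (1 - t) • x₀) ∂μ) / pt x) :
    ∀ x, 0 < qt x →
      DifferentiableAt ℝ (fun y => Real.log (qt y)) x ∧
      DifferentiableAt ℝ (fun y => Real.log (pt y)) x ∧
      DifferentiableAt ℝ (fun y => Real.log (g y)) x ∧
      gradient (fun y => Real.log (qt y)) x
        = gradient (fun y => Real.log (pt y)) x
          + gradient (fun y => Real.log (g y)) x := by
  intro x hx
  obtain ⟨ht0, ht1⟩ := ht
  obtain ⟨Cb, hCb⟩ := hLbdd
  obtain ⟨c, hc⟩ : ∃ c : ℝ, c = (2 * π * t ^ 2) ^ (-(D : ℝ) / 2) := ⟨_, rfl⟩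
  have hc0 : 0 < c := by rw [hc]; positivity
  rw [← hc] at hφ
  have hφe : φ = fun z => c * Real.exp (-‖z‖ ^ 2 / (2 * t ^ 2)) := funext hφ
  have hφpos : ∀ z, 0 < φ z := fun z => by rw [hφ]; positivity
  have hsm : ContDiff ℝ 1 φ := by
    rw [hφe]
    exact contDiff_const.mul (((contDiff_norm_sq ℝ).neg.div_const _).exp)
  have hφc : ∀ z, |φ z| ≤ c := fun z => by
    rw [abs_of_pos (hφpos z), hφ]
    refine mul_le_of_le_one_right hc0.le (Real.exp_le_one_iff.2 ?_)
    rw [neg_div]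
    exact neg_nonpos.2 (by positivity)
  have hb1 : ∀ z, |φ z| ≤ max c (c / t) := fun z => (hφc z).trans (le_max_left _ _)
  have hb2 : ∀ z, ‖fderiv ℝ φ z‖ ≤ max c (c / t) := fun z => by
    refine le_trans ?_ (le_max_right _ _)
    rw [hφe]
    exact aux_bound c t hc0.le ht0 z
  set N : EuclideanSpace ℝ (Fin D) → ℝ := fun y => ∫ x₀, L x₀ * φ (y - (1 - t) • x₀) ∂μ with hN
  have dN : DifferentiableAt ℝ N x :=
    aux_diff μ L hLmeas Cb (fun y => by rw [abs_of_nonneg (hL0 y)]; exact hCb y)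
      φ hsm _ hb1 hb2 (1 - t) x
  have hpe : pt = fun y => ∫ x₀, 1 * φ (y - (1 - t) • x₀) ∂μ := by
    funext y; rw [hpt]; simp
  have dp : DifferentiableAt ℝ pt x := by
    rw [hpe]
    exact aux_diff μ (fun _ => 1) measurable_const 1 (by simp) φ hsm _ hb1 hb2 (1 - t) x
  have hppos : ∀ y, 0 < pt y := fun y => by
    have hcont := hsm.continuous
    have hi : Integrable (fun x₀ => φ (y - (1 - t) • x₀)) μ :=
      Integrable.of_bound (Continuous.aestronglyMeasurable (by fun_prop)) c
        (Filter.Eventually.of_forall fun x₀ => hφc _)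
    rw [hpt, integral_pos_iff_support_of_nonneg (fun x₀ => (hφpos _).le) hi]
    have : Function.support (fun x₀ => φ (y - (1 - t) • x₀)) = Set.univ := by
      ext x₀; simp [(hφpos _).ne']
    rw [this]
    exact Measure.measure_univ_pos.2 hμ
  have hqe : qt = fun y => N y / ∫ x₀, L x₀ ∂μ := funext hqt
  have hge : g = fun y => N y / pt y := funext hg
  have dq : DifferentiableAt ℝ qt x := by
    rw [hqe]; simp only [div_eq_mul_inv]; exact dN.mul_const _
  have hNpos : 0 < N x := by
    rw [hqe] at hx
    exact (div_pos_iff_of_pos_right hLint).1 hx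
  have dg : DifferentiableAt ℝ g x := by
    rw [hge]; simp only [div_eq_mul_inv]; exact dN.mul (dp.inv (hppos x).ne')
  have hgpos : 0 < g x := by rw [hg]; exact div_pos hNpos (hppos x)
  have lq := dq.log hx.ne'
  have lp := dp.log (hppos x).ne'
  have lg := dg.log hgpos.ne'
  refine ⟨lq, lp, lg, ?_⟩
  have hev : (fun y => Real.log (qt y)) =ᶠ[nhds x]
      fun y => (Real.log (pt y) + Real.log (g y)) - Real.log (∫ x₀, L x₀ ∂μ) := by
    filter_upwards [dN.continuousAt.eventually (lt_mem_nhds hNpos)] with y hy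
    rw [hqe, hge]
    simp only
    rw [Real.log_div hy.ne' hLint.ne', Real.log_div hy.ne' (hppos y).ne']
    ring
  simp only [gradient]
  rw [hev.fderiv_eq, fderiv_sub_const, fderiv_fun_add lp lg, map_add]
end

section
/- Let D be a positive natural number, η ∈ [0,1], y₀ ∈ ℝ^D, and let s_θ : ℝ^D × (0,1) → ℝ^D be any function. Define v_unc(x,t) = −x/(1−t) − (t/(1−t)) s_θ(x,t); for σ > 0 define ℓ_σ(x,t) = −(x − (1−t)y₀)/((1−t)²σ² + t²) and V_SGPP^σ(x,t) = (1−η) v_unc(x,t) + η(−x/(1−t) − (t/(1−t)) ℓ_σ(x,t)). Define v_θ(x,τ) := −v_unc(x, 1−τ) for τ ∈ (0,1) and V_RF(x,τ) = (1−η) v_θ(x,τ) + η (y₀ − x)/(1−τ). Then for every t ∈ (0,1) and every x ∈ ℝ^D, the limit as σ → 0⁺ of V_SGPP^σ(x,t) exists and equals −V_RF(x, 1−t). -/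
open Filter

/-- Equivalence of hard-guidance SGPP and RF-Inversion: in the limit `σ → 0⁺`
the SGPP velocity field equals the time-reversed RF-Inversion field,
`lim_{σ→0⁺} V_SGPP^σ(x,t) = −V_RF(x, 1−t)`. -/
theorem sgpp_rf_inversion_equivalence
    (D : ℕ) (hD : 0 < D) (η : ℝ) (hη : η ∈ Set.Icc (0 : ℝ) 1)
    (y₀ : EuclideanSpace ℝ (Fin D))
    (sθ : EuclideanSpace ℝ (Fin D) → ℝ → EuclideanSpace ℝ (Fin D))
    (vunc : EuclideanSpace ℝ (Fin D) → ℝ → EuclideanSpace ℝ (Fin D))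
    (hvunc : ∀ x t, vunc x t = -((1 - t)⁻¹ • x) - (t / (1 - t)) • sθ x t)
    (ℓ : ℝ → EuclideanSpace ℝ (Fin D) → ℝ → EuclideanSpace ℝ (Fin D))
    (hℓ : ∀ σ x t, ℓ σ x t = -(((1 - t) ^ 2 * σ ^ 2 + t ^ 2)⁻¹ • (x - (1 - t) • y₀)))
    (VSGPP : ℝ → EuclideanSpace ℝ (Fin D) → ℝ → EuclideanSpace ℝ (Fin D))
    (hVSGPP : ∀ σ x t, VSGPP σ x t
        = (1 - η) • vunc x t + η • (-((1 - t)⁻¹ • x) - (t / (1 - t)) • ℓ σ x t))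
    (vθ : EuclideanSpace ℝ (Fin D) → ℝ → EuclideanSpace ℝ (Fin D))
    (hvθ : ∀ x τ, vθ x τ = -vunc x (1 - τ))
    (VRF : EuclideanSpace ℝ (Fin D) → ℝ → EuclideanSpace ℝ (Fin D))
    (hVRF : ∀ x τ, VRF x τ = (1 - η) • vθ x τ + η • ((1 - τ)⁻¹ • (y₀ - x))) :
    ∀ t ∈ Set.Ioo (0 : ℝ) 1, ∀ x : EuclideanSpace ℝ (Fin D),
      Tendsto (fun σ => VSGPP σ x t) (nhdsWithin 0 (Set.Ioi 0))
        (nhds (-VRF x (1 - t))) := by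
  intro t ht x
  obtain ⟨h0, h1⟩ := ht
  have ht0 : t ≠ 0 := h0.ne'
  have ht1 : 1 - t ≠ 0 := by linarith
  have key : VSGPP 0 x t = -VRF x (1 - t) := by
    rw [hVSGPP, hVRF, hvθ, hℓ, sub_sub_cancel]
    ext i
    simp only [PiLp.add_apply, PiLp.sub_apply, PiLp.neg_apply, PiLp.smul_apply, smul_eq_mul]
    field_simp
    ring
  rw [← key]
  have hc : ContinuousAt (fun σ => VSGPP σ x t) 0 := by
    simp only [hVSGPP, hℓ]
    have hne : (1 - t) ^ 2 * (0 : ℝ) ^ 2 + t ^ 2 ≠ 0 := by positivity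
    have hi : ContinuousAt (fun σ : ℝ => ((1 - t) ^ 2 * σ ^ 2 + t ^ 2)⁻¹) 0 :=
      ContinuousAt.inv₀ (by fun_prop) hne
    fun_prop
  exact hc.tendsto.mono_left nhdsWithin_le_nhds
end
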